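/- arXiv:math/0409430 — 2 statements merged into one kernel-verified Lean document; each statement's English description precedes it below -/
import Mathlib

section
/- Let Γ and μ be nonnegative Borel measures on ℝ^d such that every Schwartz function is integrable with respect to both Γ and μ, and suppose μ is the spectral measure of Γ, i.e. ∫_{ℝ^d} 𝓕φ dμ = ∫_{ℝ^d} φ dΓ for every Schwartz function φ on ℝ^d. Then for every γ > 0 and every ξ ∈ ℝ^d, ∫_{ℝ^d} (1 + ‖ξ − η‖²)^{−γ} μ(dη) ≤ ∫_{ℝ^d} (1 + ‖η‖²)^{−γ} μ(dη); in particular, sup_{ξ ∈ ℝ^d} ∫_{ℝ^d} (1 + ‖ξ − η‖²)^{−γ} μ(dη) is attained by the untranslated integral. -/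
open Real MeasureTheory SchwartzMap
open scoped FourierTransform

theorem Complex.norm_iteratedFDeriv_real_exp (n : ℕ) (z : ℂ) :
    ‖iteratedFDeriv ℝ n Complex.exp z‖ = Real.exp z.re := by
  have h := (Complex.contDiff_exp (𝕜 := ℂ) (n := n)).contDiffAt (x := z)
  have h' := h.restrictScalars_iteratedFDeriv (𝕜 := ℝ)
  have h'' : ‖iteratedFDeriv ℝ n Complex.exp z‖ = ‖iteratedFDeriv ℂ n Complex.exp z‖ := by
    rw [← h']
    exact ContinuousMultilinearMap.norm_restrictScalars _
  rw [h'', norm_iteratedFDeriv_eq_norm_iteratedDeriv, iteratedDeriv_eq_iterate,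
    Complex.iter_deriv_exp, Complex.norm_exp]

theorem one_add_pow_mul_exp_neg_mul_sq_le {b : ℝ} (hb : 0 < b) (N : ℕ) {r : ℝ} (hr : 0 ≤ r) :
    (1 + r) ^ N * Real.exp (-b * r ^ 2) ≤ N.factorial * Real.exp (1 + 1 / (4 * b)) := by
  have h1 : (1 + r) ^ N ≤ N.factorial * Real.exp (1 + r) := by
    have := Real.pow_div_factorial_le_exp (x := 1 + r) (by positivity) N
    rwa [div_le_iff₀' (by positivity)] at this
  calc (1 + r) ^ N * Real.exp (-b * r ^ 2)
      ≤ N.factorial * Real.exp (1 + r) * Real.exp (-b * r ^ 2) := by gcongr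
    _ = N.factorial * Real.exp (1 + r + -b * r ^ 2) := by rw [mul_assoc, ← Real.exp_add]
    _ ≤ _ := by
      refine mul_le_mul_of_nonneg_left (Real.exp_le_exp.2 ?_) (by positivity)
      have h : 1 / (4 * b) - (r - b * r ^ 2) = b * (r - 1 / (2 * b)) ^ 2 := by
        field_simp
        ring
      have : 0 ≤ b * (r - 1 / (2 * b)) ^ 2 := by positivity
      linarith

section Gaussian

variable {V : Type*} [NormedAddCommGroup V] [InnerProductSpace ℝ V]

theorem hasTemperateGrowth_gaussian_phase (b : ℝ) (w : V) :
    (fun v : V ↦ -(b : ℂ) * (‖v‖ : ℂ) ^ 2 + 2 * π * Complex.I * (inner ℝ w v : ℝ)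
      ).HasTemperateGrowth := by
  have h1 : (fun v : V ↦ ((‖v‖ ^ 2 : ℝ) : ℂ)).HasTemperateGrowth := by fun_prop
  have h2 : (fun v : V ↦ ((inner ℝ w v : ℝ) : ℂ)).HasTemperateGrowth := by fun_prop
  push_cast at h1
  fun_prop

/-- The Gaussian `v ↦ exp (-b ‖v‖ ^ 2)` modulated by `v ↦ exp (2 π i ⟪w, v⟫)`,
as a Schwartz function. -/
noncomputable def modulatedGaussian {b : ℝ} (hb : 0 < b) (w : V) : SchwartzMap V ℂ where
  toFun v := Complex.exp (-(b : ℂ) * (‖v‖ : ℂ) ^ 2 + 2 * π * Complex.I * (inner ℝ w v : ℝ))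
  smooth' := Complex.contDiff_exp.comp (hasTemperateGrowth_gaussian_phase b w).1
  decay' k n := by
    have hg := hasTemperateGrowth_gaussian_phase b w
    obtain ⟨m, C, hC, hbound⟩ := hg.norm_iteratedFDeriv_le_uniform n
    refine ⟨n.factorial * (1 + C) ^ n *
      ((k + m * n).factorial * Real.exp (1 + 1 / (4 * b))), fun v ↦ ?_⟩
    have hv : (1 : ℝ) ≤ 1 + ‖v‖ := by simp
    have hre : (-(b : ℂ) * (‖v‖ : ℂ) ^ 2 + 2 * π * Complex.I * (inner ℝ w v : ℝ)).re
        = -b * ‖v‖ ^ 2 := by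
      simp [← Complex.ofReal_pow]
    have key := norm_iteratedFDeriv_comp_le (𝕜 := ℝ) (g := Complex.exp) (n := n)
      (Complex.contDiff_exp (n := (⊤ : ℕ∞))) hg.1 (mod_cast le_top) v
      (C := Real.exp (-b * ‖v‖ ^ 2)) (D := (1 + C) * (1 + ‖v‖) ^ m)
      (fun i _ ↦ by rw [Complex.norm_iteratedFDeriv_real_exp, hre])
      (fun i hi hin ↦ by
        have h1 : 1 ≤ (1 + C) * (1 + ‖v‖) ^ m :=
          one_le_mul_of_one_le_of_one_le (by linarith) (one_le_pow₀ hv)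
        calc _ ≤ C * (1 + ‖v‖) ^ m := hbound i hin v
          _ ≤ (1 + C) * (1 + ‖v‖) ^ m := by gcongr; linarith
          _ ≤ _ := le_self_pow₀ h1 (by omega))
    calc _ ≤ (1 + ‖v‖) ^ k * (n.factorial * Real.exp (-b * ‖v‖ ^ 2) *
            ((1 + C) * (1 + ‖v‖) ^ m) ^ n) := by
          refine mul_le_mul ?_ key (norm_nonneg _) (by positivity)
          gcongr
          linarith
      _ = n.factorial * (1 + C) ^ n *
            ((1 + ‖v‖) ^ (k + m * n) * Real.exp (-b * ‖v‖ ^ 2)) := by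
          rw [mul_pow, ← pow_mul, pow_add]
          ring
      _ ≤ _ := by
          gcongr ?_ * ?_
          exact one_add_pow_mul_exp_neg_mul_sq_le hb _ (norm_nonneg v)

theorem modulatedGaussian_apply {b : ℝ} (hb : 0 < b) (w v : V) :
    modulatedGaussian hb w v =
      Complex.exp (-(b : ℂ) * (‖v‖ : ℂ) ^ 2 + 2 * π * Complex.I * (inner ℝ w v : ℝ)) := rfl

theorem modulatedGaussian_zero_apply {b : ℝ} (hb : 0 < b) (v : V) :
    modulatedGaussian hb (0 : V) v = (Real.exp (-b * ‖v‖ ^ 2) : ℝ) := by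
  simp [modulatedGaussian_apply]

theorem norm_modulatedGaussian {b : ℝ} (hb : 0 < b) (w v : V) :
    ‖modulatedGaussian hb w v‖ = Real.exp (-b * ‖v‖ ^ 2) := by
  rw [modulatedGaussian_apply, Complex.norm_exp]
  simp [← Complex.ofReal_pow]

theorem isLocallyFiniteMeasure_of_integrable_schwartzMap [MeasurableSpace V] {μ : Measure V}
    (hint : ∀ φ : SchwartzMap V ℂ, Integrable (⇑φ) μ) : IsLocallyFiniteMeasure μ := by
  refine ⟨fun x ↦ ⟨{v | Real.exp (-1 * (‖x‖ + 1) ^ 2) ≤ ‖modulatedGaussian one_pos (0 : V) v‖},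
    ?_, (hint _).measure_norm_ge_lt_top (Real.exp_pos _)⟩⟩
  filter_upwards [Metric.ball_mem_nhds x one_pos] with v hv
  have hv' : ‖v‖ ≤ ‖x‖ + 1 := by
    have := norm_le_norm_add_norm_sub' v x
    rw [mem_ball_iff_norm] at hv
    linarith
  simp only [norm_modulatedGaussian]
  gcongr Real.exp ?_
  have : ‖v‖ ^ 2 ≤ (‖x‖ + 1) ^ 2 := by gcongr
  linarith

variable [FiniteDimensional ℝ V] [MeasurableSpace V] [BorelSpace V]

theorem fourier_modulatedGaussian {b : ℝ} (hb : 0 < b) (w v : V) :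
    𝓕 (⇑(modulatedGaussian hb w)) v =
      (((π / b) ^ (Module.finrank ℝ V / 2 : ℝ) * Real.exp (-(π ^ 2 / b) * ‖w - v‖ ^ 2) : ℝ) :
        ℂ) := by
  have h := fourier_gaussian_innerProductSpace' (b := (b : ℂ)) (by simpa using hb) w v
  refine Eq.trans h ?_
  rw [Complex.ofReal_mul, Complex.ofReal_cpow (by positivity)]
  push_cast
  congr 2
  ring

/-- A nonnegative definite measure with spectral measure `μ` forces Gaussian averages of `μ` to be
largest when centred at the origin. -/
theorem lintegral_gaussian_translate_le {Γ μ : Measure V}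
    (hintF : ∀ φ : SchwartzMap V ℂ, Integrable (𝓕 (⇑φ)) μ)
    (hspec : ∀ φ : SchwartzMap V ℂ, ∫ ξ, 𝓕 (⇑φ) ξ ∂μ = ∫ x, φ x ∂Γ)
    {t : ℝ} (ht : 0 < t) (ξ : V) :
    ∫⁻ η, ENNReal.ofReal (Real.exp (-t * ‖ξ - η‖ ^ 2)) ∂μ
      ≤ ∫⁻ η, ENNReal.ofReal (Real.exp (-t * ‖η‖ ^ 2)) ∂μ := by
  have hb : 0 < π ^ 2 / t := by positivity
  set b := π ^ 2 / t with hbdef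
  have hbt : π ^ 2 / b = t := by rw [hbdef]; field_simp
  set c : ℝ := (π / b) ^ (Module.finrank ℝ V / 2 : ℝ) with hc
  have hcpos : 0 < c := by positivity
  have hF (w v : V) : 𝓕 (⇑(modulatedGaussian hb w)) v =
      ((c * Real.exp (-t * ‖w - v‖ ^ 2) : ℝ) : ℂ) := by
    rw [fourier_modulatedGaussian, hbt]
  have hint (w : V) : Integrable (fun v ↦ Real.exp (-t * ‖w - v‖ ^ 2)) μ := by
    have h := (hintF (modulatedGaussian hb w)).re.const_mul c⁻¹
    refine h.congr (.of_forall fun v ↦ ?_)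
    simp only [hF, RCLike.re_to_complex, Complex.ofReal_re]
    field_simp
  have hval (w : V) : ((c * ∫ v, Real.exp (-t * ‖w - v‖ ^ 2) ∂μ : ℝ) : ℂ) =
      ∫ x, modulatedGaussian hb w x ∂Γ := by
    rw [← hspec]
    simp_rw [hF]
    rw [integral_complex_ofReal, integral_const_mul]
  have hzero : c * ∫ v, Real.exp (-t * ‖0 - v‖ ^ 2) ∂μ = ∫ x, Real.exp (-b * ‖x‖ ^ 2) ∂Γ := by
    have h := hval 0
    simp_rw [modulatedGaussian_zero_apply] at h
    rw [integral_complex_ofReal] at h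
    exact_mod_cast h
  have hle : c * ∫ v, Real.exp (-t * ‖ξ - v‖ ^ 2) ∂μ ≤
      c * ∫ v, Real.exp (-t * ‖0 - v‖ ^ 2) ∂μ := by
    calc _ ≤ ‖((c * ∫ v, Real.exp (-t * ‖ξ - v‖ ^ 2) ∂μ : ℝ) : ℂ)‖ := by
          rw [Complex.norm_real]
          exact le_abs_self _
      _ ≤ ∫ x, ‖modulatedGaussian hb ξ x‖ ∂Γ := by
          rw [hval]
          exact norm_integral_le_integral_norm _
      _ = _ := by
          rw [hzero]
          simp_rw [norm_modulatedGaussian]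
  have hle' := ENNReal.ofReal_le_ofReal (le_of_mul_le_mul_left hle hcpos)
  rw [ofReal_integral_eq_lintegral_ofReal (hint ξ) (.of_forall fun _ ↦ (Real.exp_pos _).le),
    ofReal_integral_eq_lintegral_ofReal (hint 0) (.of_forall fun _ ↦ (Real.exp_pos _).le)] at hle'
  simpa using hle'

end Gaussian

theorem ofReal_one_add_rpow_neg_eq_lintegral {γ s : ℝ} (hγ : 0 < γ) (hs : 0 ≤ s) :
    ENNReal.ofReal ((1 + s) ^ (-γ)) =
      ∫⁻ t in Set.Ioi (0 : ℝ), ENNReal.ofReal ((Real.Gamma γ)⁻¹ * (t ^ (γ - 1) * Real.exp (-t))) *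
        ENNReal.ofReal (Real.exp (-t * s)) := by
  have hr : 0 < 1 + s := by positivity
  have hΓ : 0 < Real.Gamma γ := Real.Gamma_pos_of_pos hγ
  have heq := Real.integral_rpow_mul_exp_neg_mul_Ioi hγ hr
  have hne : (1 / (1 + s)) ^ γ * Real.Gamma γ ≠ 0 := by positivity
  have hint : Integrable (fun t : ℝ ↦ t ^ (γ - 1) * Real.exp (-((1 + s) * t)))
      (volume.restrict (Set.Ioi 0)) := by
    by_contra h
    exact hne (heq ▸ integral_undef h)
  have h1 : (1 + s) ^ (-γ) =
      ∫ t in Set.Ioi (0 : ℝ), (Real.Gamma γ)⁻¹ * (t ^ (γ - 1) * Real.exp (-((1 + s) * t))) := by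
    rw [integral_const_mul, heq, one_div, Real.inv_rpow hr.le, Real.rpow_neg hr.le]
    field_simp
  rw [h1, ofReal_integral_eq_lintegral_ofReal (hint.const_mul _)]
  · refine setLIntegral_congr_fun measurableSet_Ioi fun t ht ↦ ?_
    have ht' : (0 : ℝ) < t := ht
    rw [← ENNReal.ofReal_mul (by positivity), mul_assoc, mul_assoc, ← Real.exp_add]
    ring_nf
  · filter_upwards [ae_restrict_mem measurableSet_Ioi] with t ht
    have ht' : (0 : ℝ) < t := ht
    show 0 ≤ _
    positivity

theorem stmt_3 (d : ℕ) (hd : 1 ≤ d)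
    (Γ μ : Measure (EuclideanSpace ℝ (Fin d)))
    (hintΓ : ∀ φ : SchwartzMap (EuclideanSpace ℝ (Fin d)) ℂ, Integrable (⇑φ) Γ)
    (hintμ : ∀ φ : SchwartzMap (EuclideanSpace ℝ (Fin d)) ℂ, Integrable (⇑φ) μ)
    (hintF : ∀ φ : SchwartzMap (EuclideanSpace ℝ (Fin d)) ℂ, Integrable (𝓕 (⇑φ)) μ)
    (hspec : ∀ φ : SchwartzMap (EuclideanSpace ℝ (Fin d)) ℂ,
      ∫ ξ, 𝓕 (⇑φ) ξ ∂μ = ∫ x, φ x ∂Γ)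
    (γ : ℝ) (hγ : 0 < γ) (ξ : EuclideanSpace ℝ (Fin d)) :
    ∫⁻ η, ENNReal.ofReal ((1 + ‖ξ - η‖ ^ 2) ^ (-γ)) ∂μ
      ≤ ∫⁻ η, ENNReal.ofReal ((1 + ‖η‖ ^ 2) ^ (-γ)) ∂μ := by
  have := isLocallyFiniteMeasure_of_integrable_schwartzMap hintμ
  simp_rw [ofReal_one_add_rpow_neg_eq_lintegral hγ (sq_nonneg _)]
  refine (lintegral_lintegral_swap (by fun_prop)).trans_le
    (le_of_le_of_eq ?_ (lintegral_lintegral_swap (by fun_prop)).symm)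
  refine setLIntegral_mono' measurableSet_Ioi fun (t : ℝ) ht ↦ ?_
  rw [lintegral_const_mul _ (by fun_prop), lintegral_const_mul _ (by fun_prop)]
  exact mul_le_mul_right (lintegral_gaussian_translate_le hintF hspec (Set.mem_Ioi.1 ht) ξ) _
end

section
/- Let k > 0, 0 ≤ α < k, 0 < β < d with β < 2(k − α), and t₀ ∈ (0,1]. Let p(ξ) = (2π)^{−d/2} e^{−‖ξ‖²/2} be the standard Gaussian density on ℝ^d. Then there exists a constant C > 0 such that for all t₁, t₂ with t₀ ≤ t₁ ≤ t₂ ≤ 1, ∫_0^{t₁} ds ∫_{ℝ^d} dξ p(ξ)² ∫_{ℝ^d} dη ‖η‖^{β−d} (1 + ‖ξ − η‖²)^{α} (sin((t₂ − s)‖ξ − η‖^k) − sin((t₁ − s)‖ξ − η‖^k))² / ‖ξ − η‖^{2k} ≥ C (t₂ − t₁)^{2 − (β + 2α)/k}. -/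
open Real MeasureTheory
open scoped Pointwise

/-- The time average of `cos²` at frequency `l` is bounded below uniformly, provided `h * l ≤ 2`. -/
lemma ofReal_le_lintegral_cos_sq {t₀ t₁ h l : ℝ} (ht₀ : 0 < t₀) (ht : t₀ ≤ t₁) (hh : 0 < h)
    (hl : 0 < l) (hhl : h * l ≤ 2) :
    ENNReal.ofReal (t₀ / 200) ≤
      ∫⁻ s in Set.Ioc (0 : ℝ) t₁, ENNReal.ofReal (cos ((t₁ + h / 2 - s) * l) ^ 2) := by
  rcases lt_or_ge (t₀ * l) 2 with hs | hs
  · calc ENNReal.ofReal (t₀ / 200)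
        = ∫⁻ s in Set.Ioc (t₁ - t₀ / 8) t₁, ENNReal.ofReal (1 / 25) := by
          rw [setLIntegral_const, Real.volume_Ioc, ← ENNReal.ofReal_mul (by norm_num)]
          congr 1
          ring
      _ ≤ ∫⁻ s in Set.Ioc (t₁ - t₀ / 8) t₁,
            ENNReal.ofReal (cos ((t₁ + h / 2 - s) * l) ^ 2) := by
          refine setLIntegral_mono' measurableSet_Ioc fun s hsm => ENNReal.ofReal_le_ofReal ?_
          have h0 : 0 ≤ (t₁ + h / 2 - s) * l := mul_nonneg (by linarith [hsm.2]) hl.le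
          have h1 : (t₁ + h / 2 - s) * l ≤ 5 / 4 := by
            have : (t₁ + h / 2 - s) * l ≤ (t₀ / 8 + h / 2) * l :=
              mul_le_mul_of_nonneg_right (by linarith [hsm.1]) hl.le
            nlinarith
          have h2 := Real.one_sub_sq_div_two_le_cos (x := (t₁ + h / 2 - s) * l)
          have h3 : 1 / 5 ≤ cos ((t₁ + h / 2 - s) * l) := by nlinarith
          nlinarith
      _ ≤ _ := lintegral_mono_set (Set.Ioc_subset_Ioc_left (by linarith))
  · have hc : Continuous fun s : ℝ => cos ((t₁ + h / 2 - s) * l) ^ 2 := by fun_prop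
    have ht₁ : 0 ≤ t₁ := ht₀.le.trans ht
    rw [← ofReal_integral_eq_lintegral_ofReal
      ((hc.integrableOn_Icc (a := 0) (b := t₁)).mono_set Set.Ioc_subset_Icc_self)
      (Filter.Eventually.of_forall fun s => sq_nonneg _)]
    apply ENNReal.ofReal_le_ofReal
    rw [← intervalIntegral.integral_of_le ht₁]
    have he : ∀ s : ℝ, (t₁ + h / 2 - s) * l = (t₁ + h / 2) * l - l * s := fun s => by ring
    simp only [he]
    rw [intervalIntegral.integral_comp_sub_mul (fun x => cos x ^ 2) hl.ne', integral_cos_sq,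
      smul_eq_mul]
    generalize hA : (t₁ + h / 2) * l - l * 0 = A
    generalize hB : (t₁ + h / 2) * l - l * t₁ = B
    have hAB : A - B = l * t₁ := by rw [← hA, ← hB]; ring
    have h1 : -(1 / 2) ≤ cos A * sin A := by
      nlinarith [sq_nonneg (cos A + sin A), sin_sq_add_cos_sq A]
    have h2 : cos B * sin B ≤ 1 / 2 := by
      nlinarith [sq_nonneg (cos B - sin B), sin_sq_add_cos_sq B]
    rw [inv_mul_eq_div, le_div_iff₀ hl]
    nlinarith [mul_le_mul_of_nonneg_right ht hl.le]

/-- Lower bound for the spatial integrand on the shell `r < x < q * r` with `q ^ k = 2` and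
`h * r ^ k = 1`, where `x = ‖ξ - η‖` and `n = ‖η‖`. -/
lemma const_mul_cos_sq_le_integrand {k α γ h r q x n u v : ℝ} (hk : 0 < k) (hα : 0 ≤ α)
    (hγ : γ < 0) (hr : 1 ≤ r) (hq : 0 < q) (hqk : q ^ k = 2) (hrk : h * r ^ k = 1)
    (hx₁ : r ≤ x) (hx₂ : x ≤ q * r) (hn₀ : 0 < n) (hn : n ≤ x + 1) (huv : u - v = h) :
    (2 * q) ^ γ * sin (1 / 2) ^ 2 * r ^ (γ + 2 * α - 2 * k) * cos ((u + v) / 2 * x ^ k) ^ 2 ≤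
      n ^ γ * (1 + x ^ 2) ^ α * (sin (u * x ^ k) - sin (v * x ^ k)) ^ 2 / x ^ (2 * k) := by
  have hr0 : 0 < r := by linarith
  have hx0 : 0 < x := by linarith
  have hh : 0 < h := by
    by_contra hneg
    have := rpow_pos_of_pos hr0 k
    nlinarith
  have h1 : (2 * q) ^ γ * r ^ γ ≤ n ^ γ := by
    rw [← mul_rpow (by positivity) hr0.le]
    exact rpow_le_rpow_of_nonpos hn₀ (by linarith) hγ.le
  have h2 : r ^ (2 * α) ≤ (1 + x ^ 2) ^ α := by
    rw [rpow_mul hr0.le]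
    apply rpow_le_rpow (by positivity) _ hα
    rw [rpow_two]
    nlinarith
  have h3 : x ^ (2 * k) ≤ 4 * r ^ (2 * k) := by
    calc x ^ (2 * k) ≤ (q * r) ^ (2 * k) := rpow_le_rpow hx0.le hx₂ (by positivity)
      _ = 4 * r ^ (2 * k) := by
        rw [mul_rpow hq.le hr0.le, mul_comm 2 k, rpow_mul hq.le, hqk]
        norm_num
  have h4 : 1 ≤ h * x ^ k := by
    rw [← hrk]
    exact mul_le_mul_of_nonneg_left (rpow_le_rpow hr0.le hx₁ hk.le) hh.le
  have h5 : h * x ^ k ≤ 2 := by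
    have := rpow_le_rpow hx0.le hx₂ hk.le
    rw [mul_rpow hq.le hr0.le, hqk] at this
    nlinarith
  have h6 : sin (1 / 2) ≤ sin (h * x ^ k / 2) :=
    sin_le_sin_of_le_of_le_pi_div_two (by linarith [pi_gt_three]) (by linarith [pi_gt_three])
      (by linarith)
  have h7 : 0 < sin (1 / 2) := sin_pos_of_pos_of_lt_pi (by norm_num) (by linarith [pi_gt_three])
  have h8 : (sin (u * x ^ k) - sin (v * x ^ k)) ^ 2 =
      4 * sin (h * x ^ k / 2) ^ 2 * cos ((u + v) / 2 * x ^ k) ^ 2 := by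
    rw [sin_sub_sin, ← huv]
    ring_nf
  have h9 : r ^ (γ + 2 * α - 2 * k) = r ^ γ * r ^ (2 * α) / r ^ (2 * k) := by
    rw [rpow_sub hr0, rpow_add hr0]
  rw [h8, h9]
  calc _ = ((2 * q) ^ γ * r ^ γ) * r ^ (2 * α) *
        (4 * sin (1 / 2) ^ 2 * cos ((u + v) / 2 * x ^ k) ^ 2) / (4 * r ^ (2 * k)) := by
        field_simp
    _ ≤ _ := by gcongr

theorem stmt_13 (d : ℕ) (hd : 1 ≤ d) (k α β t₀ : ℝ) (hk : 0 < k) (hα0 : 0 ≤ α)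
    (hαk : α < k) (hβ0 : 0 < β) (hβd : β < d) (hβ : β < 2 * (k - α))
    (ht₀ : t₀ ∈ Set.Ioc (0 : ℝ) 1) :
    ∃ C : ℝ, 0 < C ∧ ∀ t₁ t₂ : ℝ, t₀ ≤ t₁ → t₁ ≤ t₂ → t₂ ≤ 1 →
      ENNReal.ofReal (C * (t₂ - t₁) ^ (2 - (β + 2 * α) / k))
        ≤ ∫⁻ s in Set.Ioc (0 : ℝ) t₁,
            ∫⁻ ξ : EuclideanSpace ℝ (Fin d),
              ∫⁻ η : EuclideanSpace ℝ (Fin d),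
                ENNReal.ofReal
                  (((2 * Real.pi) ^ (-(d : ℝ) / 2) * Real.exp (-‖ξ‖ ^ 2 / 2)) ^ 2 *
                    (‖η‖ ^ (β - d) * (1 + ‖ξ - η‖ ^ 2) ^ α *
                      (Real.sin ((t₂ - s) * ‖ξ - η‖ ^ k)
                        - Real.sin ((t₁ - s) * ‖ξ - η‖ ^ k)) ^ 2 /
                      ‖ξ - η‖ ^ (2 * k))) := by
  have : Nonempty (Fin d) := ⟨⟨0, hd⟩⟩
  obtain ⟨q, hq⟩ : ∃ q : ℝ, q = 2 ^ k⁻¹ := ⟨_, rfl⟩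
  have hq1 : 1 < q := hq ▸ one_lt_rpow (by norm_num) (inv_pos.2 hk)
  have hqk : q ^ k = 2 := by rw [hq, rpow_inv_rpow (by norm_num) hk.ne']
  obtain ⟨B, hB⟩ : ∃ B : Set (EuclideanSpace ℝ (Fin d)), B = Metric.ball 0 1 := ⟨_, rfl⟩
  obtain ⟨S, hS⟩ : ∃ S : Set (EuclideanSpace ℝ (Fin d)), S = {x | 1 < ‖x‖ ∧ ‖x‖ < q} := ⟨_, rfl⟩
  have hSo : IsOpen S := by
    rw [hS]
    exact (isOpen_lt continuous_const continuous_norm).inter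
      (isOpen_lt continuous_norm continuous_const)
  have hSv : 0 < volume.real S := by
    rw [measureReal_def]
    refine ENNReal.toReal_pos (hSo.measure_pos volume ?_).ne' ?_
    · obtain ⟨x, hx⟩ := exists_norm_eq (EuclideanSpace ℝ (Fin d))
        (show (0 : ℝ) ≤ (1 + q) / 2 by linarith)
      refine ⟨x, ?_⟩
      rw [hS, Set.mem_ofPred_eq, hx]
      constructor <;> linarith
    · refine (lt_of_le_of_lt (measure_mono ?_)
        (measure_ball_lt_top (x := (0 : EuclideanSpace ℝ (Fin d))) (r := q))).ne
      intro x hx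
      rw [hS] at hx
      simpa using hx.2
  have hBv : 0 < volume.real B := by
    rw [hB, measureReal_def]
    exact ENNReal.toReal_pos (Metric.measure_ball_pos volume _ one_pos).ne' measure_ball_lt_top.ne
  have hBfin : volume B ≠ ⊤ := hB ▸ measure_ball_lt_top.ne
  have hSfin : volume S ≠ ⊤ := fun h => by simp [measureReal_def, h] at hSv
  obtain ⟨P, hP⟩ : ∃ P : ℝ, P = ((2 * π) ^ (-(d : ℝ) / 2) * exp (-1 / 2)) ^ 2 := ⟨_, rfl⟩
  have hP0 : 0 < P := by rw [hP]; positivity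
  have hsin : 0 < sin (1 / 2) := sin_pos_of_pos_of_lt_pi (by norm_num) (by linarith [pi_gt_three])
  obtain ⟨c, hc⟩ : ∃ c : ℝ, c = P * ((2 * q) ^ (β - d) * sin (1 / 2) ^ 2) := ⟨_, rfl⟩
  have hc0 : 0 < c := by rw [hc]; positivity
  refine ⟨c * volume.real B * volume.real S * (t₀ / 200), by have := ht₀.1; positivity, ?_⟩
  intro t₁ t₂ h₁ h₂ h₃
  have hexp : 0 < 2 - (β + 2 * α) / k := by
    rw [sub_pos, div_lt_iff₀ hk]
    linarith
  rcases h₂.eq_or_lt with rfl | h₂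
  · simp [zero_rpow hexp.ne']
  obtain ⟨h, hh⟩ : ∃ h : ℝ, h = t₂ - t₁ := ⟨_, rfl⟩
  have hh0 : 0 < h := by linarith
  have hh1 : h ≤ 1 := by linarith [ht₀.1]
  obtain ⟨r, hr⟩ : ∃ r : ℝ, r = h ^ (-k⁻¹) := ⟨_, rfl⟩
  have hr1 : 1 ≤ r := hr ▸ one_le_rpow_of_pos_of_le_one_of_nonpos hh0 hh1
    (neg_nonpos.2 (inv_pos.2 hk).le)
  have hr0 : 0 < r := by linarith
  have hrk : h * r ^ k = 1 := by
    rw [hr, ← rpow_mul hh0.le, neg_mul, inv_mul_cancel₀ hk.ne', rpow_neg_one,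
      mul_inv_cancel₀ hh0.ne']
  have hpow : r ^ (β - d + 2 * α - 2 * k) * r ^ d = h ^ (2 - (β + 2 * α) / k) := by
    rw [← rpow_natCast r d, ← rpow_add hr0, hr, ← rpow_mul hh0.le]
    congr 1
    field_simp
    ring
  obtain ⟨K, hK⟩ : ∃ K : ℝ, K = c * r ^ (β - d + 2 * α - 2 * k) := ⟨_, rfl⟩
  have hK0 : 0 ≤ K := by rw [hK]; positivity
  obtain ⟨A, hA⟩ : ∃ A : Set (EuclideanSpace ℝ (Fin d)), A = r • S := ⟨_, rfl⟩
  have hAv : volume A = ENNReal.ofReal (r ^ d * volume.real S) := by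
    rw [hA, Measure.addHaar_smul, finrank_euclideanSpace_fin, abs_of_pos (by positivity),
      ENNReal.ofReal_mul (by positivity), measureReal_def, ENNReal.ofReal_toReal hSfin]
  have hAm : MeasurableSet A := by
    rw [hA]
    exact (hSo.smul₀ hr0.ne').measurableSet
  have hAn : ∀ x ∈ A, r < ‖x‖ ∧ ‖x‖ ≤ q * r := by
    intro x hx
    rw [hA] at hx
    obtain ⟨y, hy, rfl⟩ := hx
    rw [hS] at hy
    simp only [norm_smul, norm_of_nonneg hr0.le]
    rw [mul_comm q]
    exact ⟨lt_mul_of_one_lt_right hr0 hy.1, mul_le_mul_of_nonneg_left hy.2.le hr0.le⟩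
  have hBm : MeasurableSet B := hB ▸ measurableSet_ball
  calc ENNReal.ofReal
        (c * volume.real B * volume.real S * (t₀ / 200) * (t₂ - t₁) ^ (2 - (β + 2 * α) / k))
      = ENNReal.ofReal (K * volume.real B) * (ENNReal.ofReal (t₀ / 200) * volume A) := by
        have := ht₀.1
        rw [hAv, ← ENNReal.ofReal_mul (by positivity), ← ENNReal.ofReal_mul (by positivity),
          ← hh, ← hpow, hK]
        congr 1
        ring
    _ ≤ ENNReal.ofReal (K * volume.real B) * ∫⁻ ζ in A, ∫⁻ s in Set.Ioc (0 : ℝ) t₁,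
          ENNReal.ofReal (cos ((t₁ + h / 2 - s) * ‖ζ‖ ^ k) ^ 2) := by
        gcongr
        rw [← setLIntegral_const]
        refine setLIntegral_mono' hAm fun ζ hζ => ?_
        have hz := hAn ζ hζ
        refine ofReal_le_lintegral_cos_sq ht₀.1 h₁ hh0 (rpow_pos_of_pos (by linarith) k) ?_
        have := rpow_le_rpow (norm_nonneg ζ) hz.2 hk.le
        rw [mul_rpow (by linarith) hr0.le, hqk] at this
        calc h * ‖ζ‖ ^ k ≤ h * (2 * r ^ k) := mul_le_mul_of_nonneg_left this hh0.le
          _ = 2 := by rw [mul_left_comm, hrk, mul_one]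
    _ = ENNReal.ofReal (K * volume.real B) * ∫⁻ s in Set.Ioc (0 : ℝ) t₁, ∫⁻ ζ in A,
          ENNReal.ofReal (cos ((t₁ + h / 2 - s) * ‖ζ‖ ^ k) ^ 2) := by
        rw [lintegral_lintegral_swap]
        apply Measurable.aemeasurable
        unfold Function.uncurry
        fun_prop
    _ = ∫⁻ s in Set.Ioc (0 : ℝ) t₁, ∫⁻ ξ in B, ∫⁻ ζ in A,
          ENNReal.ofReal (K * cos ((t₁ + h / 2 - s) * ‖ζ‖ ^ k) ^ 2) := by
        rw [← lintegral_const_mul' _ _ ENNReal.ofReal_ne_top]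
        refine lintegral_congr fun s => ?_
        simp_rw [ENNReal.ofReal_mul hK0]
        rw [setLIntegral_const, lintegral_const_mul' _ _ ENNReal.ofReal_ne_top, measureReal_def,
          ENNReal.ofReal_toReal hBfin]
        ring
    _ ≤ _ := by
        refine lintegral_mono fun s => (setLIntegral_mono' hBm fun ξ hξ => ?_).trans
          (setLIntegral_le_lintegral B _)
        have hξ : ‖ξ‖ < 1 := by simpa [hB] using hξ
        rw [← lintegral_sub_left_eq_self (μ := volume) _ ξ]
        refine (setLIntegral_mono' hAm fun ζ hζ => ENNReal.ofReal_le_ofReal ?_).trans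
          (setLIntegral_le_lintegral A _)
        rw [sub_sub_cancel]
        obtain ⟨hz1, hz2⟩ := hAn ζ hζ
        have hn0 : 0 < ‖ξ - ζ‖ := by
          have := norm_sub_norm_le ζ ξ
          rw [norm_sub_rev] at this
          linarith
        have hn1 : ‖ξ - ζ‖ ≤ ‖ζ‖ + 1 := by linarith [norm_sub_le ξ ζ]
        have key := const_mul_cos_sq_le_integrand (u := t₂ - s) (v := t₁ - s) hk hα0
          (sub_neg.2 hβd) hr1 (by linarith) hqk hrk hz1.le hz2 hn0 hn1 (by linarith)
        have hmid : (t₂ - s + (t₁ - s)) / 2 = t₁ + h / 2 - s := by linarith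
        rw [hmid] at key
        have hPle : P ≤ ((2 * π) ^ (-(d : ℝ) / 2) * exp (-‖ξ‖ ^ 2 / 2)) ^ 2 := by
          have hsq : ‖ξ‖ ^ 2 ≤ 1 := pow_le_one₀ (norm_nonneg ξ) hξ.le
          rw [hP]
          gcongr
        calc _ = P * ((2 * q) ^ (β - d) * sin (1 / 2) ^ 2 * r ^ (β - d + 2 * α - 2 * k) *
              cos ((t₁ + h / 2 - s) * ‖ζ‖ ^ k) ^ 2) := by rw [hK, hc]; ring
          _ ≤ _ := by gcongr
end
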